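/- Let C and D be monoidal categories and let F : C ⥤ D be a monoidal functor which is an equivalence of categories. Then there exists a braided monoidal functor from the Drinfeld center Z(C) to the Drinfeld center Z(D) which is an equivalence of categories. -/

import Mathlib

open CategoryTheory

set_option linter.unusedSectionVars false
set_option linter.unusedSimpArgs false

namespace CenterEquiv

open MonoidalCategory Functor.LaxMonoidal Functor.OplaxMonoidal Functor.Monoidal

universe v₁ v₂ u₁ u₂

theorem aux {D : Type u₂} [Category.{v₂} D] [MonoidalCategory D] {Y A B U V : D}
    (p : Y ⊗ A ⟶ A ⊗ Y) (p' : Y ⊗ U ⟶ U ⊗ Y) (q : Y ⊗ B ⟶ B ⊗ Y) (q' : Y ⊗ V ⟶ V ⊗ Y)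
    (i : A ⟶ U) (j : B ⟶ V) (hi : Y ◁ i ≫ p' = p ≫ i ▷ Y) (hj : Y ◁ j ≫ q' = q ≫ j ▷ Y) :
    Y ◁ (i ⊗ₘ j) ≫ (α_ _ _ _).inv ≫ p' ▷ V ≫ (α_ _ _ _).hom ≫ U ◁ q' ≫ (α_ _ _ _).inv =
    (α_ _ _ _).inv ≫ p ▷ B ≫ (α_ _ _ _).hom ≫ A ◁ q ≫ (α_ _ _ _).inv ≫ (i ⊗ₘ j) ▷ Y := by
  rw [tensorHom_def']
  calc
    _ = 𝟙 _ ⊗≫ (Y ⊗ A) ◁ j ⊗≫ (Y ◁ i ≫ p') ▷ V ⊗≫ U ◁ q' ⊗≫ 𝟙 _ := by monoidal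
    _ = 𝟙 _ ⊗≫ ((Y ⊗ A) ◁ j ≫ p ▷ V) ⊗≫ (i ▷ (Y ⊗ V) ≫ U ◁ q') ⊗≫ 𝟙 _ := by
      rw [hi]; monoidal
    _ = 𝟙 _ ⊗≫ p ▷ B ⊗≫ A ◁ (Y ◁ j ≫ q') ⊗≫ i ▷ (V ⊗ Y) ⊗≫ 𝟙 _ := by
      rw [whisker_exchange p j, ← whisker_exchange i q']; monoidal
    _ = _ := by rw [hj]; monoidal

section extend

variable {C : Type u₁} [Category.{v₁} C]
  {D : Type u₂} [Category.{v₂} D] [MonoidalCategory D]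
  (F : C ⥤ D) [F.IsEquivalence]
variable (Y : D) (b : ∀ A : C, Y ⊗ F.obj A ≅ F.obj A ⊗ Y)

noncomputable def extβ (U : D) : Y ⊗ U ≅ U ⊗ Y :=
  whiskerLeftIso Y (F.objObjPreimageIso U).symm ≪≫ b _ ≪≫
    whiskerRightIso (F.objObjPreimageIso U) Y

theorem extβ_spec (nat : ∀ {A B : C} (f : A ⟶ B),
    Y ◁ F.map f ≫ (b B).hom = (b A).hom ≫ F.map f ▷ Y) {A : C} {U : D} (f : F.obj A ⟶ U) :
    Y ◁ f ≫ (extβ F Y b U).hom = (b A).hom ≫ f ▷ Y := by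
  obtain ⟨g, hg⟩ := F.map_surjective (f ≫ (F.objObjPreimageIso U).inv)
  have hf : f = F.map g ≫ (F.objObjPreimageIso U).hom := by simp [hg]
  have h2 : Y ◁ f ≫ Y ◁ (F.objObjPreimageIso U).inv = Y ◁ F.map g := by
    rw [hg, whiskerLeft_comp]
  simp only [extβ, Iso.trans_hom, whiskerLeftIso_hom, whiskerRightIso_hom, Iso.symm_hom]
  rw [reassoc_of% h2, reassoc_of% nat g, ← comp_whiskerRight, ← hf]

noncomputable def extHB [MonoidalCategory C] [F.Monoidal] (nat : ∀ {A B : C} (f : A ⟶ B),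
      Y ◁ F.map f ≫ (b B).hom = (b A).hom ≫ F.map f ▷ Y)
    (mon : ∀ A B : C, Y ◁ μ F A B ≫ (b (A ⊗ B)).hom =
      (α_ _ _ _).inv ≫ (b A).hom ▷ F.obj B ≫ (α_ _ _ _).hom ≫ F.obj A ◁ (b B).hom ≫
        (α_ _ _ _).inv ≫ μ F A B ▷ Y) : HalfBraiding Y where
  β := extβ F Y b
  naturality {U U'} f := by
    rw [← cancel_epi (Y ◁ (F.objObjPreimageIso U).hom), ← whiskerLeft_comp_assoc,
      extβ_spec F Y b nat, reassoc_of% extβ_spec F Y b nat, comp_whiskerRight]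
  monoidal U U' := by
    let i := (F.objObjPreimageIso U).hom
    let j := (F.objObjPreimageIso U').hom
    have hi := extβ_spec F Y b nat i
    have hj := extβ_spec F Y b nat j
    have h := extβ_spec F Y b nat (δ F _ _ ≫ (i ⊗ₘ j))
    rw [← cancel_epi (Y ◁ (i ⊗ₘ j)), ← cancel_epi (Y ◁ (δ F _ _)), ← whiskerLeft_comp_assoc, h,
      ← cancel_epi (Y ◁ (μ F _ _)), reassoc_of% mon, aux _ _ _ _ i j hi hj]
    simp only [whiskerLeft_μ_δ_assoc, comp_whiskerRight, whiskerRight_μ_δ_assoc]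

end extend

variable {C : Type u₁} [Category.{v₁} C] [MonoidalCategory C]
  {D : Type u₂} [Category.{v₂} D] [MonoidalCategory D]
  (F : C ⥤ D) [F.Monoidal] [F.IsEquivalence]

/-- transported half braiding on image objects -/
def imβ {X : C} (b : HalfBraiding X) (A : C) : F.obj X ⊗ F.obj A ≅ F.obj A ⊗ F.obj X :=
  μIso F X A ≪≫ F.mapIso (b.β A) ≪≫ (μIso F A X).symm

theorem imβ_hom {X : C} (b : HalfBraiding X) (A : C) :
    (imβ F b A).hom = μ F X A ≫ F.map (b.β A).hom ≫ δ F A X := rfl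

theorem imβ_nat {X : C} (b : HalfBraiding X) {A B : C} (f : A ⟶ B) :
    F.obj X ◁ F.map f ≫ (imβ F b B).hom = (imβ F b A).hom ≫ F.map f ▷ F.obj X := by
  simp only [imβ_hom, Category.assoc, δ_natural_left, μ_natural_right_assoc]
  rw [← F.map_comp_assoc, b.naturality, F.map_comp_assoc]

theorem imβ_mon {X : C} (b : HalfBraiding X) (A B : C) :
    F.obj X ◁ μ F A B ≫ (imβ F b (A ⊗ B)).hom =
      (α_ _ _ _).inv ≫ (imβ F b A).hom ▷ F.obj B ≫ (α_ _ _ _).hom ≫ F.obj A ◁ (imβ F b B).hom ≫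
        (α_ _ _ _).inv ≫ μ F A B ▷ F.obj X := by
  simp only [imβ_hom, b.monoidal, F.map_comp, map_whiskerLeft, map_whiskerRight, map_associator, map_associator_inv,
    Category.assoc, comp_whiskerRight, MonoidalCategory.whiskerLeft_comp, μ_δ, μ_δ_assoc, δ_μ, δ_μ_assoc,
    whiskerLeft_μ_δ, whiskerLeft_μ_δ_assoc, whiskerLeft_δ_μ, whiskerLeft_δ_μ_assoc,
    whiskerRight_μ_δ, whiskerRight_μ_δ_assoc, whiskerRight_δ_μ, whiskerRight_δ_μ_assoc,
    Iso.hom_inv_id, Iso.hom_inv_id_assoc, Iso.inv_hom_id, Iso.inv_hom_id_assoc, Category.comp_id, Category.id_comp]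

noncomputable def objHB {X : C} (b : HalfBraiding X) : HalfBraiding (F.obj X) :=
  extHB F (F.obj X) (imβ F b) (imβ_nat F b) (imβ_mon F b)

theorem objHB_spec {X : C} (b : HalfBraiding X) {A : C} {U : D} (f : F.obj A ⟶ U) :
    F.obj X ◁ f ≫ ((objHB F b).β U).hom = (imβ F b A).hom ≫ f ▷ F.obj X :=
  extβ_spec F _ _ (imβ_nat F b) f

theorem objHB_obj {X : C} (b : HalfBraiding X) (A : C) :
    ((objHB F b).β (F.obj A)).hom = (imβ F b A).hom := by
  simpa using objHB_spec F b (𝟙 (F.obj A))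

/-- commutation with half braidings can be tested on the image of `F`. -/
theorem comm_of_obj {P Q : D} (p : HalfBraiding P) (q : HalfBraiding Q) (f : P ⟶ Q)
    (h : ∀ A : C, f ▷ F.obj A ≫ (q.β (F.obj A)).hom = (p.β (F.obj A)).hom ≫ F.obj A ◁ f) (U : D) :
    f ▷ U ≫ (q.β U).hom = (p.β U).hom ≫ U ◁ f := by
  rw [← cancel_epi (P ◁ (F.objObjPreimageIso U).hom), p.naturality_assoc, ← whisker_exchange,
    reassoc_of% (h _).symm, whisker_exchange_assoc, q.naturality]

noncomputable def cObj (X : Center C) : Center D := ⟨F.obj X.1, objHB F X.2⟩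

def homMk {P Q : Center D} (f : P.1 ⟶ Q.1) 
    (h : ∀ A : C, f ▷ F.obj A ≫ (Q.2.β (F.obj A)).hom = (P.2.β (F.obj A)).hom ≫ F.obj A ◁ f) :
    P ⟶ Q := ⟨f, comm_of_obj F P.2 Q.2 f h⟩

noncomputable def G : Center C ⥤ Center D where
  obj X := cObj F X
  map {X Y} f := homMk F (P := cObj F X) (Q := cObj F Y) (F.map f.f) (fun A => by
    simp only [cObj, objHB_obj, imβ_hom, μ_natural_left_assoc, Category.assoc, δ_natural_right]
    rw [← F.map_comp_assoc, f.comm, F.map_comp_assoc])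
  map_id X := by apply Center.ext; exact F.map_id _
  map_comp f g := by apply Center.ext; exact F.map_comp _ _

theorem hμ_raw {X Y : C} (b : HalfBraiding X) (c : HalfBraiding Y) (A : C) :
    μ F X Y ▷ F.obj A ≫ (μ F (X ⊗ Y) A ≫ F.map ((α_ _ _ _).hom ≫
    X ◁ (c.β A).hom ≫ (α_ _ _ _).inv ≫ (b.β A).hom ▷ Y ≫ (α_ _ _ _).hom) ≫
      δ F A (X ⊗ Y)) =
      ((α_ _ _ _).hom ≫ F.obj X ◁ (imβ F c A).hom ≫ (α_ _ _ _).inv ≫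
        (imβ F b A).hom ▷ F.obj Y ≫ (α_ _ _ _).hom) ≫ F.obj A ◁ μ F X Y := by
  simp only [imβ_hom, F.map_comp, map_whiskerLeft, map_whiskerRight, map_associator, map_associator_inv,
    Category.assoc, comp_whiskerRight, MonoidalCategory.whiskerLeft_comp, μ_δ, μ_δ_assoc, δ_μ, δ_μ_assoc,
    whiskerLeft_μ_δ, whiskerLeft_μ_δ_assoc, whiskerLeft_δ_μ, whiskerLeft_δ_μ_assoc,
    whiskerRight_μ_δ, whiskerRight_μ_δ_assoc, whiskerRight_δ_μ, whiskerRight_δ_μ_assoc,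
    Iso.hom_inv_id, Iso.hom_inv_id_assoc, Iso.inv_hom_id, Iso.inv_hom_id_assoc, Category.comp_id, Category.id_comp]

theorem hμ_comm (X Y : Center C) (A : C) :
    μ F X.1 Y.1 ▷ F.obj A ≫ (imβ F (X ⊗ Y).2 A).hom =
      ((α_ _ _ _).hom ≫ F.obj X.1 ◁ (imβ F Y.2 A).hom ≫ (α_ _ _ _).inv ≫
        (imβ F X.2 A).hom ▷ F.obj Y.1 ≫ (α_ _ _ _).hom) ≫ F.obj A ◁ μ F X.1 Y.1 :=
  hμ_raw F X.2 Y.2 A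

noncomputable def hμ (X Y : Center C) : (G F).obj X ⊗ (G F).obj Y ⟶ (G F).obj (X ⊗ Y) :=
  homMk F (μ F X.1 Y.1) (fun A => by
    have h := hμ_comm F X Y A
    simp only [← objHB_obj] at h
    exact h)

theorem hε_raw (A : C) :
    ε F ▷ F.obj A ≫ μ F (𝟙_ C) A ≫ F.map ((λ_ _).hom ≫ (ρ_ _).inv) ≫ δ F A (𝟙_ C) =
      ((λ_ _).hom ≫ (ρ_ _).inv) ≫ F.obj A ◁ ε F := by
  simp only [F.map_comp, map_leftUnitor, map_rightUnitor_inv,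
    whiskerRight_ε_η_assoc, Category.assoc, comp_whiskerRight, MonoidalCategory.whiskerLeft_comp, μ_δ, μ_δ_assoc, δ_μ, δ_μ_assoc,
    whiskerLeft_μ_δ, whiskerLeft_μ_δ_assoc, whiskerLeft_δ_μ, whiskerLeft_δ_μ_assoc,
    whiskerRight_μ_δ, whiskerRight_μ_δ_assoc, whiskerRight_δ_μ, whiskerRight_δ_μ_assoc,
    Iso.hom_inv_id, Iso.hom_inv_id_assoc, Iso.inv_hom_id, Iso.inv_hom_id_assoc, Category.comp_id, Category.id_comp]

theorem hε_comm (A : C) :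
    ε F ▷ F.obj A ≫ (imβ F (𝟙_ (Center C)).2 A).hom =
      ((λ_ _).hom ≫ (ρ_ _).inv) ≫ F.obj A ◁ ε F :=
  hε_raw F A

noncomputable def hε : 𝟙_ (Center D) ⟶ (G F).obj (𝟙_ (Center C)) :=
  homMk F (ε F) (fun A => by
    have h := hε_comm F A
    simp only [← objHB_obj] at h
    exact h)

noncomputable def μI (X Y : Center C) : (G F).obj X ⊗ (G F).obj Y ≅ (G F).obj (X ⊗ Y) :=
  haveI : IsIso (hμ F X Y).f := inferInstanceAs (IsIso (μ F X.1 Y.1))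
  Center.isoMk (hμ F X Y)

noncomputable def εI : 𝟙_ (Center D) ≅ (G F).obj (𝟙_ (Center C)) :=
  haveI : IsIso (hε F).f := inferInstanceAs (IsIso (ε F))
  Center.isoMk (hε F)

noncomputable def coreG : (G F).CoreMonoidal where
  εIso := εI F
  μIso := μI F
  μIso_hom_natural_left {X Y} f X' := by
    apply Center.ext; exact μ_natural_left F f.f X'.1
  μIso_hom_natural_right {X Y} X' f := by
    apply Center.ext; exact μ_natural_right F X'.1 f.f
  associativity X Y Z := by
    apply Center.ext; exact associativity F X.1 Y.1 Z.1
  left_unitality X := by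
    apply Center.ext; exact left_unitality F X.1
  right_unitality X := by
    apply Center.ext; exact right_unitality F X.1

@[reducible] noncomputable def braidedG : (G F).Braided where
  toMonoidal := (coreG F).toMonoidal
  braided X Y := by
    apply Center.ext
    change μ F X.1 Y.1 ≫ F.map (X.2.β Y.1).hom =
      ((objHB F X.2).β (F.obj Y.1)).hom ≫ μ F Y.1 X.1
    rw [objHB_obj, imβ_hom]
    simp

instance : (G F).Faithful where
  map_injective {X Y f g} h := by
    apply Center.ext
    exact F.map_injective (congrArg Center.Hom.f h)

instance : (G F).Full where
  map_surjective {X Y} g := by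
    obtain ⟨f, hf⟩ := F.map_surjective (X := X.1) (Y := Y.1) g.f
    refine ⟨⟨f, fun U => ?_⟩, Center.ext _ _ hf⟩
    have h := g.comm (F.obj U)
    rw [← hf] at h
    change F.map f ▷ F.obj U ≫ ((objHB F Y.2).β (F.obj U)).hom =
      ((objHB F X.2).β (F.obj U)).hom ≫ F.obj U ◁ F.map f at h
    rw [objHB_obj, objHB_obj] at h
    simp only [imβ_hom, μ_natural_left_assoc, Category.assoc, δ_natural_right] at h
    apply F.map_injective
    rw [← cancel_epi (μ F _ _), ← cancel_mono (δ F _ _)]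
    simpa using h

section ess

variable {Y : D} (c : HalfBraiding Y) {X : C} (j : F.obj X ≅ Y)

def conjβ (A : C) : F.obj X ⊗ F.obj A ≅ F.obj A ⊗ F.obj X :=
  whiskerRightIso j _ ≪≫ c.β (F.obj A) ≪≫ whiskerLeftIso _ j.symm

theorem conjβ_hom (A : C) : (conjβ F c j A).hom =
    j.hom ▷ _ ≫ (c.β (F.obj A)).hom ≫ _ ◁ j.inv := rfl

theorem conjβ_nat {A B : C} (f : A ⟶ B) :
    F.obj X ◁ F.map f ≫ (conjβ F c j B).hom = (conjβ F c j A).hom ≫ F.map f ▷ F.obj X := by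
  simp only [conjβ_hom, Category.assoc]
  rw [whisker_exchange_assoc, c.naturality_assoc, whisker_exchange]

theorem conjβ_mon (A B : C) :
    F.obj X ◁ μ F A B ≫ (conjβ F c j (A ⊗ B)).hom =
      (α_ _ _ _).inv ≫ (conjβ F c j A).hom ▷ F.obj B ≫ (α_ _ _ _).hom ≫
        F.obj A ◁ (conjβ F c j B).hom ≫ (α_ _ _ _).inv ≫ μ F A B ▷ F.obj X := by
  simp only [conjβ_hom, Category.assoc]
  rw [whisker_exchange_assoc, c.naturality_assoc, ← whisker_exchange, c.monoidal]
  simp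

noncomputable def preβ (A : C) : F.obj (X ⊗ A) ≅ F.obj (A ⊗ X) :=
  (μIso F _ _).symm ≪≫ conjβ F c j A ≪≫ μIso F _ _

theorem preβ_hom (A : C) : (preβ F c j A).hom = δ F _ _ ≫ (conjβ F c j A).hom ≫ μ F _ _ := rfl

noncomputable def preHB : HalfBraiding X where
  β A := F.preimageIso (preβ F c j A)
  naturality {A B} f := by
    apply F.map_injective
    simp only [F.map_comp, Functor.preimageIso_hom, Functor.map_preimage, preβ_hom]
    rw [← δ_natural_right_assoc, reassoc_of% conjβ_nat F c j f, μ_natural_left]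
    simp only [Category.assoc]
  monoidal A B := by
    apply F.map_injective
    simp only [Functor.preimageIso_hom, Functor.map_preimage, preβ_hom, F.map_comp, map_whiskerLeft, map_whiskerRight, map_associator, map_associator_inv,
    Category.assoc, comp_whiskerRight, MonoidalCategory.whiskerLeft_comp, μ_δ, μ_δ_assoc, δ_μ, δ_μ_assoc,
    whiskerLeft_μ_δ, whiskerLeft_μ_δ_assoc, whiskerLeft_δ_μ, whiskerLeft_δ_μ_assoc,
    whiskerRight_μ_δ, whiskerRight_μ_δ_assoc, whiskerRight_δ_μ, whiskerRight_δ_μ_assoc,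
    Iso.hom_inv_id, Iso.hom_inv_id_assoc, Iso.inv_hom_id, Iso.inv_hom_id_assoc, Category.comp_id, Category.id_comp]
    have h := conjβ_mon F c j A B
    rw [← cancel_epi (F.obj X ◁ δ F A B), whiskerLeft_δ_μ_assoc] at h
    rw [h]
    simp only [Category.assoc, comp_whiskerRight, MonoidalCategory.whiskerLeft_comp, μ_δ, μ_δ_assoc, δ_μ, δ_μ_assoc,
    whiskerLeft_μ_δ, whiskerLeft_μ_δ_assoc, whiskerLeft_δ_μ, whiskerLeft_δ_μ_assoc,
    whiskerRight_μ_δ, whiskerRight_μ_δ_assoc, whiskerRight_δ_μ, whiskerRight_δ_μ_assoc,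
    Iso.hom_inv_id, Iso.hom_inv_id_assoc, Iso.inv_hom_id, Iso.inv_hom_id_assoc, Category.comp_id, Category.id_comp]

theorem imβ_preHB (A : C) : (imβ F (preHB F c j) A).hom = j.hom ▷ _ ≫
    (c.β (F.obj A)).hom ≫ _ ◁ j.inv := by
  simp [imβ_hom, preHB, preβ_hom, conjβ_hom]

theorem imβ_preHB' (A : C) : j.hom ▷ F.obj A ≫ (c.β (F.obj A)).hom =
    ((objHB F (preHB F c j)).β (F.obj A)).hom ≫ F.obj A ◁ j.hom := by
  rw [objHB_obj, imβ_preHB]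
  simp

end ess

instance : (G F).EssSurj where
  mem_essImage Y := by
    let f : (G F).obj ⟨_, preHB F Y.2 (F.objObjPreimageIso Y.1)⟩ ⟶ Y :=
      homMk F (F.objObjPreimageIso Y.1).hom (imβ_preHB' F Y.2 _)
    have : IsIso f.f := inferInstanceAs (IsIso (F.objObjPreimageIso Y.1).hom)
    exact ⟨_, ⟨Center.isoMk f⟩⟩

instance : (G F).IsEquivalence where

end CenterEquiv

theorem center_braided_equivalence_of_monoidal_equivalence
    (C : Type*) [Category C] [MonoidalCategory C]
    (D : Type*) [Category D] [MonoidalCategory D]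
    (F : C ⥤ D) [F.Monoidal] [F.IsEquivalence] :
    ∃ (G : Center C ⥤ Center D) (_ : G.Braided), G.IsEquivalence :=
  ⟨CenterEquiv.G F, CenterEquiv.braidedG F, inferInstance⟩
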